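/- Let N ∈ ℕ and l > 0, and let f : ℝ² → ℝ² be a Lipschitz, injective map satisfying f(x + Nu) = f(x) + lNu for all x ∈ ℝ² and all u ∈ I. Then the Lebesgue measure of the image of the fundamental parallelogram satisfies λ(f(U_N)) = l² · λ(U_N) = l² N² · (√3/2). In particular, λ(f(U_N)) does not depend on f. -/

import Mathlib

open MeasureTheory

/-- `τ = e^{iπ/3}`. -/
noncomputable def tau : ℂ := Complex.exp (Real.pi / 3 * Complex.I)

/-- The standard triangular lattice `I = ℤ + τℤ` in `ℝ² = ℂ`. -/
noncomputable def latI : AddSubgroup ℂ := AddSubgroup.closure {1, tau}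

/-- The fundamental parallelogram `U_N = {s + tτ : s, t ∈ [0, N]}`. -/
def UN (N : ℕ) : Set ℂ :=
  {p | ∃ s t : ℝ, s ∈ Set.Icc (0 : ℝ) N ∧ t ∈ Set.Icc (0 : ℝ) N ∧ p = s + t * tau}

open Complex

/-- A continuous self-map of the plane at bounded distance from a dilation is onto. -/
lemma surj_aux (l C : ℝ) (hl : 0 < l) (f : ℂ → ℂ) (hf : Continuous f)
    (hC : ∀ x, ‖f x - l * x‖ ≤ C) : Function.Surjective f := by
  by_contra hns
  simp only [Function.Surjective, not_forall, not_exists] at hns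
  obtain ⟨y, hy⟩ := hns
  have hsc : IsSimplyConnected (Set.univ : Set ℂ) :=
    by
    have : SimplyConnectedSpace (Set.univ : Set ℂ) :=
      have : ContractibleSpace (Set.univ : Set ℂ) := (convex_univ : Convex ℝ (Set.univ : Set ℂ)).contractibleSpace ⟨0, trivial⟩
      inferInstance
    exact this
  obtain ⟨h, hhc, hh⟩ := exists_continuousOn_eqOn_exp_comp hsc isOpen_univ
    (g := fun x => f x - y) (by fun_prop) (by simpa [sub_eq_zero] using hy)
  rw [continuousOn_univ] at hhc
  have hh' : ∀ x, exp (h x) = f x - y := fun x => hh (Set.mem_univ x)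
  have hC0 : 0 ≤ C := (norm_nonneg _).trans (hC 0)
  set R : ℝ := (C + ‖y‖ + 1) / l with hR
  have hRpos : 0 < R := by positivity
  have hlR : l * R = C + ‖y‖ + 1 := by rw [hR]; field_simp
  -- the loop
  let z : ℝ → ℂ := fun t => R * exp (t * I)
  have hzc : Continuous z := by fun_prop
  have hzn : ∀ t, ‖z t‖ = R := fun t => by
    simp [z, norm_exp_ofReal_mul_I, abs_of_pos hRpos]
  have hz0 : ∀ t, (l : ℂ) * z t ≠ 0 := fun t => by
    have : z t ≠ 0 := by
      rw [← norm_pos_iff, hzn]; exact hRpos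
    exact mul_ne_zero (by exact_mod_cast hl.ne') this
  let q : ℝ → ℂ := fun t => (f (z t) - y) / (l * z t)
  have hq : ∀ t, q t ∈ slitPlane := by
    intro t
    have h1 : ‖1 + (q t - 1)‖ = ‖q t‖ := by ring_nf
    have hlt : ‖q t - 1‖ < 1 := by
      have : q t - 1 = (f (z t) - l * z t - y) / (l * z t) := by
        simp only [q]; rw [sub_right_comm, sub_div _ ((l : ℂ) * z t), div_self (hz0 t)]
      rw [this, norm_div, norm_mul, hzn, norm_real, Real.norm_of_nonneg hl.le, hlR,
        div_lt_one (by positivity)]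
      calc _ ≤ ‖f (z t) - l * z t‖ + ‖y‖ := norm_sub_le _ _
        _ < _ := by linarith [hC (z t)]
    have := mem_slitPlane_of_norm_lt_one hlt
    simpa using this
  have hqc : Continuous q := by
    apply Continuous.div (by fun_prop) (by fun_prop) hz0
  let φ : ℝ → ℂ := fun t => h (z t) - log (q t) - t * I - Real.log (l * R)
  have hφc : Continuous φ := by
    have : Continuous fun t => log (q t) := hqc.clog hq
    fun_prop
  have hφ1 : ∀ t, exp (φ t) = 1 := by
    intro t
    have hq0 : q t ≠ 0 := slitPlane_ne_zero (hq t)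
    have hn : f (z t) - y ≠ 0 := sub_ne_zero.2 (hy _)
    simp only [φ, exp_sub]
    rw [hh', exp_log hq0, ← ofReal_exp, Real.exp_log (by positivity)]
    have := hz0 t
    simp only [q, z] at *
    push_cast
    have he := exp_ne_zero (t * I)
    have hRc : (R : ℂ) ≠ 0 := by exact_mod_cast hRpos.ne'
    have hlc : (l : ℂ) ≠ 0 := by exact_mod_cast hl.ne'
    field_simp
  choose n hn using fun t => exp_eq_one_iff.1 (hφ1 t)
  have hpi : (2 * Real.pi * I : ℂ) ≠ 0 := by simp [Real.pi_ne_zero]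
  have hnc : Continuous n := by
    have h1 : Continuous fun t => ((n t : ℤ) : ℝ) := by
      have : (fun t => ((n t : ℤ) : ℝ)) = fun t => (φ t / (2 * Real.pi * I)).re := by
        funext t
        rw [hn t, mul_div_cancel_right₀ _ hpi, intCast_re]
      rw [this]
      fun_prop
    exact Int.isClosedEmbedding_coe_real.isEmbedding.continuous_iff.2 h1
  have hconst : n 0 = n (2 * Real.pi) :=
    PreconnectedSpace.constant inferInstance hnc
  have hzz : z 0 = z (2 * Real.pi) := by simp [z, exp_two_pi_mul_I]
  have hqq : q 0 = q (2 * Real.pi) := by simp only [q, hzz]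
  have : φ 0 = φ (2 * Real.pi) := by rw [hn, hn, hconst]
  simp only [φ, hzz, hqq] at this
  apply hpi
  push_cast at this
  linear_combination this

lemma tau_re : tau.re = 1 / 2 := by
  have : tau = exp ((Real.pi / 3 : ℝ) * I) := by simp [tau]
  rw [this, exp_ofReal_mul_I_re, Real.cos_pi_div_three]

lemma tau_im : tau.im = Real.sqrt 3 / 2 := by
  have : tau = exp ((Real.pi / 3 : ℝ) * I) := by simp [tau]
  rw [this, exp_ofReal_mul_I_im, Real.sin_pi_div_three]

lemma bas_li (c : ℝ) (hc : c ≠ 0) : LinearIndependent ℝ ![(c : ℂ), c * tau] := by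
  rw [LinearIndependent.pair_iff]
  intro s t h
  have h3 : Real.sqrt 3 ≠ 0 := by positivity
  have h1 := congrArg re h
  have h2 := congrArg im h
  simp [tau_re, tau_im, hc] at h1 h2
  subst h2
  simpa [hc] using h1

/-- The basis `c, cτ` of the plane. -/
noncomputable def bas (c : ℝ) (hc : c ≠ 0) : Module.Basis (Fin 2) ℝ ℂ :=
  basisOfLinearIndependentOfCardEqFinrank (bas_li c hc) (by simp)

lemma coe_bas (c : ℝ) (hc : c ≠ 0) : ⇑(bas c hc) = ![(c : ℂ), c * tau] :=
  coe_basisOfLinearIndependentOfCardEqFinrank _ _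

lemma vol_par (c : ℝ) (hc : c ≠ 0) :
    volume (parallelepiped (bas c hc)) = ENNReal.ofReal (c ^ 2 * (Real.sqrt 3 / 2)) := by
  have hvol : (volume : Measure ℂ) = basisOneI.addHaar := by
    rw [← toBasis_orthonormalBasisOneI]
    exact orthonormalBasisOneI.addHaar_eq_volume.symm
  rw [hvol, Measure.addHaar_parallelepiped, coe_bas]
  have h : basisOneI.det ![(c : ℂ), c * tau] = c ^ 2 * (Real.sqrt 3 / 2) := by
    rw [Module.Basis.det_apply, Matrix.det_fin_two]
    simp [Module.Basis.toMatrix_apply, tau_im, tau_re]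
    ring
  rw [h, abs_of_nonneg (by positivity)]

lemma par_UN (N : ℕ) (hN : (N : ℝ) ≠ 0) : parallelepiped (bas N hN) = UN N := by
  have hNp : (0 : ℝ) < N := by positivity
  ext x
  simp only [mem_parallelepiped_iff, coe_bas, UN, Set.mem_ofPred_eq, Fin.sum_univ_two]
  constructor
  · rintro ⟨t, ⟨h0, h1⟩, rfl⟩
    refine ⟨t 0 * N, t 1 * N, ⟨?_, ?_⟩, ⟨?_, ?_⟩, ?_⟩
    · exact mul_nonneg (h0 0) hNp.le
    · exact mul_le_of_le_one_left hNp.le (h1 0)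
    · exact mul_nonneg (h0 1) hNp.le
    · exact mul_le_of_le_one_left hNp.le (h1 1)
    · simp [mul_assoc]
  · rintro ⟨s, t, ⟨hs0, hs1⟩, ⟨ht0, ht1⟩, rfl⟩
    refine ⟨![s / N, t / N], ⟨?_, ?_⟩, ?_⟩
    · intro i; fin_cases i <;> simp <;> positivity
    · intro i; fin_cases i <;> simp <;> rw [div_le_one hNp] <;> assumption
    · have : (N : ℂ) ≠ 0 := by exact_mod_cast hN
      simp
      field_simp

lemma null_image (f : ℂ → ℂ) (K : NNReal) (hf : LipschitzWith K f) (s : Set ℂ)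
    (hs : volume s = 0) : volume (f '' s) = 0 := by
  have hac : (volume : Measure ℂ) ≪ Measure.hausdorffMeasure (Module.finrank ℝ ℂ : ℝ) :=
    Measure.absolutelyContinuous_isAddHaarMeasure _ _
  have hac' : Measure.hausdorffMeasure (Module.finrank ℝ ℂ : ℝ) ≪ (volume : Measure ℂ) :=
    Measure.absolutelyContinuous_isAddHaarMeasure _ _
  apply hac
  have := hf.hausdorffMeasure_image_le (d := (Module.finrank ℝ ℂ : ℝ)) (by positivity) s
  rw [hac' hs, mul_zero] at this
  exact le_antisymm this bot_le

lemma mem_span_lat (N : ℕ) (hN : (N : ℝ) ≠ 0) (v : ℂ)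
    (hv : v ∈ Submodule.span ℤ (Set.range (bas N hN))) : ∃ u ∈ latI, v = N * u := by
  induction hv using Submodule.span_induction with
  | mem x h =>
    obtain ⟨i, rfl⟩ := h
    rw [coe_bas]
    fin_cases i
    · exact ⟨1, AddSubgroup.subset_closure (by simp), by simp⟩
    · exact ⟨tau, AddSubgroup.subset_closure (by simp), by simp⟩
  | zero => exact ⟨0, zero_mem _, by simp⟩
  | add x y _ _ hx hy =>
    obtain ⟨u, hu, rfl⟩ := hx
    obtain ⟨w, hw, rfl⟩ := hy
    exact ⟨u + w, add_mem hu hw, by ring⟩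
  | smul a x _ hx =>
    obtain ⟨u, hu, rfl⟩ := hx
    exact ⟨a • u, zsmul_mem hu a, by simp; ring⟩

lemma span_scale (l c : ℝ) (hc : c ≠ 0) (hlc : l * c ≠ 0) (w : ℂ) :
    w ∈ Submodule.span ℤ (Set.range (bas (l * c) hlc)) ↔
      ∃ v ∈ Submodule.span ℤ (Set.range (bas c hc)), w = l * v := by
  have h : Set.range (bas (l * c) hlc) = (LinearMap.mulLeft ℤ (l : ℂ)) '' Set.range (bas c hc) := by
    rw [← Set.range_comp]
    congr 1
    ext i
    rw [Function.comp_apply, coe_bas, coe_bas]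
    fin_cases i <;> simp [mul_assoc]
  rw [h, ← Submodule.map_span, Submodule.mem_map]
  simp [eq_comm]

theorem statement7 (N : ℕ) (l : ℝ) (hl : 0 < l) (f : ℂ → ℂ)
    (hf : ∃ K, LipschitzWith K f) (hinj : Function.Injective f)
    (hper : ∀ x : ℂ, ∀ u ∈ latI, f (x + N * u) = f x + (l : ℂ) * N * u) :
    volume (f '' UN N) = ENNReal.ofReal (l ^ 2) * volume (UN N) ∧
      volume (f '' UN N) = ENNReal.ofReal (l ^ 2 * N ^ 2 * (Real.sqrt 3 / 2)) := by
  obtain ⟨K, hK⟩ := hf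
  rcases Nat.eq_zero_or_pos N with rfl | hNpos
  · have : UN 0 = {0} := by
      ext x
      simp only [UN, Set.mem_ofPred_eq, Nat.cast_zero, Set.Icc_self, Set.mem_singleton_iff]
      constructor
      · rintro ⟨s, t, rfl, rfl, rfl⟩; simp
      · rintro rfl; exact ⟨0, 0, rfl, rfl, by simp⟩
    simp [this]
  have hN : (N : ℝ) ≠ 0 := by exact_mod_cast hNpos.ne'
  have hlN : l * (N : ℝ) ≠ 0 := mul_ne_zero hl.ne' hN
  have hlc : (l : ℂ) ≠ 0 := by exact_mod_cast hl.ne'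
  set F := ZSpan.fundamentalDomain (bas N hN) with hF
  have hper' : ∀ x v : ℂ, v ∈ Submodule.span ℤ (Set.range (bas N hN)) →
      f (v + x) = l * v + f x := by
    intro x v hv
    obtain ⟨u, hu, rfl⟩ := mem_span_lat N hN v hv
    rw [add_comm, hper x u hu]; ring
  have hsurj : Function.Surjective f := by
    obtain ⟨R, hR⟩ := (ZSpan.fundamentalDomain_isBounded (bas N hN)).exists_norm_le
    refine surj_aux l (K * R + ‖f 0‖ + l * R) hl f hK.continuous fun x => ?_
    obtain ⟨v, hv, -⟩ := ZSpan.exist_unique_vadd_mem_fundamentalDomain (bas N hN) x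
    have hv' : (v : ℂ) + x ∈ F := hv
    have h1 : f x - l * x = (f (v + x) - f 0) + f 0 - l * (v + x) := by
      rw [hper' x v v.2]; ring
    have h2 : ‖f (v + x) - f 0‖ ≤ K * ‖(v : ℂ) + x‖ := by
      simpa using hK.norm_sub_le ((v : ℂ) + x) 0
    have h3 := hR _ hv'
    rw [h1]
    refine (norm_sub_le _ _).trans (add_le_add ((norm_add_le _ _).trans ?_) ?_)
    · gcongr
      exact h2.trans (by gcongr)
    · rw [norm_mul, norm_real, Real.norm_of_nonneg hl.le]
      gcongr
  have hfd : IsAddFundamentalDomain (Submodule.span ℤ (Set.range (bas (l * N) hlN)))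
      (f '' F) volume := by
    refine IsAddFundamentalDomain.mk' ?_ fun y => ?_
    · exact ((ZSpan.fundamentalDomain_measurableSet _).image_of_continuousOn_injOn
        hK.continuous.continuousOn hinj.injOn).nullMeasurableSet
    · obtain ⟨x, rfl⟩ := hsurj y
      obtain ⟨v, hv, huniq⟩ := ZSpan.exist_unique_vadd_mem_fundamentalDomain (bas N hN) x
      refine ⟨⟨l * v, (span_scale l N hN hlN _).2 ⟨v, v.2, rfl⟩⟩, ?_, ?_⟩
      · exact ⟨_, hv, hper' x v v.2⟩
      · rintro ⟨w, hw⟩ ⟨p, hp, hpw⟩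
        obtain ⟨v', hv', rfl⟩ := (span_scale l N hN hlN _).1 hw
        have h1 : f p = f (v' + x) := by rw [hper' x v' hv']; exact hpw
        have h2 := hinj h1
        subst h2
        have := huniq ⟨v', hv'⟩ hp
        rw [← this]
  have hG : VAddInvariantMeasure (Submodule.span ℤ (Set.range (bas (l * N) hlN))) ℂ volume :=
    inferInstanceAs <| VAddInvariantMeasure
      (Submodule.span ℤ (Set.range (bas (l * N) hlN))).toAddSubgroup ℂ volume
  have hvF : volume (f '' F) = ENNReal.ofReal ((l * N) ^ 2 * (Real.sqrt 3 / 2)) := by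
    rw [hfd.measure_eq (ZSpan.isAddFundamentalDomain (bas (l * N) hlN) volume), ← vol_par _ hlN]
    exact measure_congr (ZSpan.fundamentalDomain_ae_parallelepiped _ _)
  have hae := ZSpan.fundamentalDomain_ae_parallelepiped (bas N hN) volume
  rw [par_UN, ← hF] at hae
  have hsub : F ⊆ UN N := by
    rw [← par_UN N hN]; exact ZSpan.fundamentalDomain_subset_parallelepiped _
  have hnull : volume (f '' (UN N \ F)) = 0 := null_image f K hK _ (ae_le_set.1 hae.symm.le)
  have hUF : volume (f '' UN N) = volume (f '' F) := by
    apply le_antisymm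
    · have : f '' UN N = f '' F ∪ f '' (UN N \ F) := by
        rw [← Set.image_union, Set.union_sdiff_cancel hsub]
      rw [this]
      refine (measure_union_le _ _).trans ?_
      rw [hnull, add_zero]
    · exact measure_mono (Set.image_mono hsub)
  rw [hUF, hvF, ← par_UN N hN, vol_par, ← ENNReal.ofReal_mul (by positivity)]
  constructor <;> congr 1 <;> ring
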